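/- Let 0 < c1 ≤ c2 be constants and let n range over an increasing sequence of integers along which c1 ≤ f(k0(n)) ≤ c2, and set λ_n = f(k0(n)) and μ_n = g(k0(n)). Let X_n be the number of independent sets of size k0(n) in G(n,1/2) and Y_n the number of (k0(n)+2)-element vertex subsets inducing a complete bipartite graph. Then |P(X_n = 0 and Y_n = 0) − e^{−λ_n−μ_n}| → 0 as n → ∞. -/

import Mathlib

open MeasureTheory ProbabilityTheory Filter Real

namespace RandomBipartiteDecomposition

/-- The set of edges of the complete bipartite graph with vertex classes `A` and `B`. -/
def bicliqueEdges {V : Type*} (A B : Finset V) : Set (Sym2 V) :=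
  {e | ∃ a ∈ A, ∃ b ∈ B, e = s(a, b)}

/-- `A`, `B` are the vertex classes of a complete bipartite subgraph of `G`. -/
def IsBicliqueIn {V : Type*} (G : SimpleGraph V) (A B : Finset V) : Prop :=
  A.Nonempty ∧ B.Nonempty ∧ Disjoint A B ∧ ∀ a ∈ A, ∀ b ∈ B, G.Adj a b

/-- A complete bipartite subgraph is nontrivial if both classes have at least 2 vertices. -/
def IsNontrivialBicliqueIn {V : Type*} (G : SimpleGraph V) (A B : Finset V) : Prop :=
  2 ≤ A.card ∧ 2 ≤ B.card ∧ Disjoint A B ∧ ∀ a ∈ A, ∀ b ∈ B, G.Adj a b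

/-- `P` lists `m` pairwise edge-disjoint complete bipartite subgraphs of `G` such that
every edge of `G` belongs to exactly one of them. -/
def IsBicliqueDecomp {V : Type*} (G : SimpleGraph V) (m : ℕ)
    (P : Fin m → Finset V × Finset V) : Prop :=
  (∀ i, IsBicliqueIn G (P i).1 (P i).2) ∧
  (∀ i j, i ≠ j →
    Disjoint (bicliqueEdges (P i).1 (P i).2) (bicliqueEdges (P j).1 (P j).2)) ∧
  (⋃ i, bicliqueEdges (P i).1 (P i).2) = G.edgeSet

/-- As above but with all complete bipartite subgraphs nontrivial. -/
def IsNontrivialBicliqueDecomp {V : Type*} (G : SimpleGraph V) (m : ℕ)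
    (P : Fin m → Finset V × Finset V) : Prop :=
  (∀ i, IsNontrivialBicliqueIn G (P i).1 (P i).2) ∧
  (∀ i j, i ≠ j →
    Disjoint (bicliqueEdges (P i).1 (P i).2) (bicliqueEdges (P j).1 (P j).2)) ∧
  (⋃ i, bicliqueEdges (P i).1 (P i).2) = G.edgeSet

/-- `τ(G)`: the minimum number of pairwise edge-disjoint complete bipartite subgraphs
of `G` so that each edge of `G` belongs to exactly one of them. -/
noncomputable def tau {V : Type*} (G : SimpleGraph V) : ℕ :=
  sInf {m | ∃ P : Fin m → Finset V × Finset V, IsBicliqueDecomp G m P}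

/-- `τ'(G)`: the minimum number of pairwise edge-disjoint *nontrivial* complete bipartite
subgraphs of `G` covering all edges of `G`; `⊤` if there is no such cover. -/
noncomputable def tau' {V : Type*} (G : SimpleGraph V) : ℕ∞ :=
  sInf {t : ℕ∞ | ∃ m : ℕ, t = m ∧ ∃ P : Fin m → Finset V × Finset V,
    IsNontrivialBicliqueDecomp G m P}

/-- `S` is an independent set of `G`. -/
def IsIndepFinset {V : Type*} (G : SimpleGraph V) (S : Finset V) : Prop :=
  ∀ a ∈ S, ∀ b ∈ S, ¬ G.Adj a b

/-- `α(G)`: the maximum size of an independent set of `G`. -/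
noncomputable def alpha {V : Type*} (G : SimpleGraph V) : ℕ :=
  sSup {k | ∃ S : Finset V, S.card = k ∧ IsIndepFinset G S}

/-- `S` induces in `G` a complete bipartite graph with nonempty vertex classes `A`, `B`. -/
def IsInducedCompleteBipartite {V : Type*} (G : SimpleGraph V) (S A B : Finset V) : Prop :=
  A.Nonempty ∧ B.Nonempty ∧ Disjoint A B ∧ (A : Set V) ∪ (B : Set V) = (S : Set V) ∧
  ∀ u ∈ S, ∀ v ∈ S, (G.Adj u v ↔ ((u ∈ A ∧ v ∈ B) ∨ (u ∈ B ∧ v ∈ A)))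

/-- `β(G)`: the largest number of vertices of an induced complete bipartite subgraph. -/
noncomputable def beta {V : Type*} (G : SimpleGraph V) : ℕ :=
  sSup {k | ∃ S A B : Finset V, IsInducedCompleteBipartite G S A B ∧ S.card = k}

/-- The Bernoulli measure on `Bool` giving `true` probability `p`. -/
noncomputable def bernoulliBool (p : ℝ) : Measure Bool :=
  p.toNNReal • Measure.dirac true + (1 - p).toNNReal • Measure.dirac false

instance (p : ℝ) : IsFiniteMeasure (bernoulliBool p) := by
  unfold bernoulliBool; infer_instance

/-- The Erdős–Rényi random graph `G(n,p)`: each unordered pair of vertices flips an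
independent `p`-coin. Events about the graph are subsets of the coin-flip space. -/
noncomputable def erdosRenyi (n : ℕ) (p : ℝ) : Measure (Sym2 (Fin n) → Bool) :=
  Measure.pi fun _ => bernoulliBool p

/-- The simple graph determined by the coin flips `ω`. -/
def graphOf (n : ℕ) (ω : Sym2 (Fin n) → Bool) : SimpleGraph (Fin n) :=
  SimpleGraph.fromEdgeSet {e | ω e = true}

/-- `f(k) = C(n,k) · 2^{-C(k,2)}`, the expected number of independent sets of size `k`
in `G(n,1/2)`. -/
noncomputable def f (n k : ℕ) : ℝ :=
  (n.choose k : ℝ) * (2 : ℝ) ^ (-(k.choose 2 : ℤ))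

/-- `k₀(n)`: the largest `k` with `f(k) ≥ 1`. -/
noncomputable def k0 (n : ℕ) : ℕ := sSup {k | 1 ≤ f n k}

/-- `g(k) = C(n,k+2) · (2^{k+1} - 1) · 2^{-C(k+2,2)}`, the expected number of induced
complete bipartite subgraphs on `k+2` vertices in `G(n,1/2)`. -/
noncomputable def g (n k : ℕ) : ℝ :=
  (n.choose (k + 2) : ℝ) * ((2 : ℝ) ^ (k + 1) - 1) * (2 : ℝ) ^ (-((k + 2).choose 2 : ℤ))

/-- The number of independent sets of size `k` in the graph determined by `ω`. -/
noncomputable def numIndep (n k : ℕ) (ω : Sym2 (Fin n) → Bool) : ℕ :=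
  Set.ncard {S : Finset (Fin n) | S.card = k ∧ IsIndepFinset (graphOf n ω) S}

/-- The number of `m`-element vertex subsets inducing a complete bipartite graph in the
graph determined by `ω`. -/
noncomputable def numBip (n m : ℕ) (ω : Sym2 (Fin n) → Bool) : ℕ :=
  Set.ncard {S : Finset (Fin n) | S.card = m ∧
    ∃ A B : Finset (Fin n), IsInducedCompleteBipartite (graphOf n ω) S A B}

section ChenStein

variable {Ω ι : Type*}

open Classical in
/-- The number of events `A i`, `i ∈ s`, that occur at `ω`. -/
noncomputable def countOccurring (A : ι → Set Ω) (s : Finset ι) (ω : Ω) : ℕ :=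
  (s.filter fun i => ω ∈ A i).card

lemma countOccurring_eq_sum_indicator (A : ι → Set Ω) (s : Finset ι) (ω : Ω) :
    (countOccurring A s ω : ℝ) = ∑ i ∈ s, (A i).indicator 1 ω := by
  classical
  simp only [countOccurring, Set.indicator_apply, Pi.one_apply, Finset.sum_boole]

variable [Fintype Ω] [MeasurableSpace Ω] [MeasurableSingletonClass Ω]

lemma measureReal_eq_sum_indicator (μ : Measure Ω) [IsFiniteMeasure μ] (S : Set Ω) :
    μ.real S = ∑ ω, μ.real {ω} * S.indicator 1 ω := by
  classical
  have h := integral_fintype (μ := μ) (f := S.indicator (1 : Ω → ℝ)) Integrable.of_finite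
  rw [integral_indicator_one S.toFinite.measurableSet] at h
  simpa using h

lemma pow_sub_pow_add_le {u : ℝ} (h0 : 0 ≤ u) (h1 : u ≤ 1) (a b : ℕ) :
    |u ^ (a + b) - u ^ a| ≤ b := by
  have hb : 1 - u ^ b ≤ b := by
    have := one_add_mul_le_pow (a := u - 1) (by linarith) b
    have h2 : (b : ℝ) * u ≥ 0 := by positivity
    rw [add_sub_cancel] at this
    nlinarith
  have h2 : u ^ b ≤ 1 := pow_le_one₀ h0 h1
  have h3 : u ^ a ≤ 1 := pow_le_one₀ h0 h1
  have h4 : 0 ≤ u ^ a := by positivity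
  rw [pow_add, abs_sub_comm, abs_of_nonneg (by nlinarith)]
  nlinarith

/-- The Chen–Stein bound of Arratia, Goldstein and Gordon for the probability that no event
of a locally dependent family occurs. -/
theorem abs_measureReal_none_occurs_sub_exp_le (μ : Measure Ω) [IsProbabilityMeasure μ]
    [DecidableEq ι] (s : Finset ι) (A : ι → Set Ω) (N : ι → ι → Prop) [DecidableRel N]
    (hN : ∀ i ∈ s, N i i)
    (hind : ∀ i ∈ s, IndepFun ((A i).indicator (1 : Ω → ℝ))
      (countOccurring A (s.filter fun j => ¬ N i j)) μ) :
    |μ.real {ω | ∀ i ∈ s, ω ∉ A i} - exp (-∑ i ∈ s, μ.real (A i))| ≤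
      ∑ i ∈ s, (∑ j ∈ s with N i j, μ.real (A i) * μ.real (A j) +
        ∑ j ∈ s with j ≠ i ∧ N i j, μ.real (A i ∩ A j)) := by
  classical
  set w : Ω → ℝ := fun ω => μ.real {ω} with hw
  have hw0 : ∀ ω, 0 ≤ w ω := fun ω => measureReal_nonneg
  have hw1 : ∑ ω, w ω = 1 := by
    have := measureReal_eq_sum_indicator μ Set.univ
    rw [probReal_univ] at this
    simpa only [Set.indicator_univ, Pi.one_apply, mul_one] using this.symm
  set I : ι → Ω → ℝ := fun i => (A i).indicator 1 with hI
  have hI0 : ∀ i ω, 0 ≤ I i ω := fun i ω => Set.indicator_nonneg (by simp) ω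
  set p : ι → ℝ := fun i => μ.real (A i) with hp
  have hpI : ∀ i, p i = ∑ ω, w ω * I i ω := fun i => measureReal_eq_sum_indicator μ _
  have hp0 : ∀ i, 0 ≤ p i := fun i => measureReal_nonneg
  set l := ∑ i ∈ s, p i with hl
  set W : Ω → ℕ := countOccurring A s with hW
  set H' : ℝ → ℝ := fun u => exp (-l * u) *
    (∑ ω, w ω * (W ω * u ^ (W ω - 1)) - l * ∑ ω, w ω * u ^ W ω) with hH'
  have hderiv : ∀ u, HasDerivAt (fun u => exp (-l * u) * ∑ ω, w ω * u ^ W ω) (H' u) u := by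
    intro u
    have h1 : HasDerivAt (fun u => exp (-l * u)) (exp (-l * u) * (-l)) u := by
      simpa using ((hasDerivAt_id u).const_mul (-l)).exp
    have h2 : HasDerivAt (fun u => ∑ ω, w ω * u ^ W ω)
        (∑ ω, w ω * (W ω * u ^ (W ω - 1))) u :=
      HasDerivAt.fun_sum fun ω _ => (hasDerivAt_pow (W ω) u).const_mul (w ω)
    exact (h1.mul h2).congr_deriv (by ring)
  set R := ∑ i ∈ s, (∑ j ∈ s with N i j, p i * p j +
        ∑ j ∈ s with j ≠ i ∧ N i j, μ.real (A i ∩ A j)) with hR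
  have hbound : ∀ u ∈ Set.Icc (0 : ℝ) 1, ‖H' u‖ ≤ R := by
    rintro u ⟨hu0, hu1⟩
    have hexp : exp (-l * u) ≤ 1 := by
      have : 0 ≤ l := Finset.sum_nonneg fun i _ => hp0 i
      rw [exp_le_one_iff]
      nlinarith
    have hsum : ∑ ω, w ω * (W ω * u ^ (W ω - 1)) - l * ∑ ω, w ω * u ^ W ω =
        ∑ i ∈ s, (∑ ω, w ω * (I i ω * u ^ (W ω - 1)) - p i * ∑ ω, w ω * u ^ W ω) := by
      rw [Finset.sum_sub_distrib, hl, Finset.sum_mul, Finset.sum_comm]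
      congr 1
      refine Finset.sum_congr rfl fun ω _ => ?_
      rw [hW, countOccurring_eq_sum_indicator, Finset.sum_mul, Finset.mul_sum]
    rw [hH', norm_mul, norm_of_nonneg (exp_pos _).le, hsum]
    refine (mul_le_of_le_one_left (norm_nonneg _) hexp).trans ?_
    refine (norm_sum_le _ _).trans (Finset.sum_le_sum fun i hi => ?_)
    set V : Ω → ℕ := countOccurring A (s.filter fun j => ¬ N i j) with hV
    have hfac : ∑ ω, w ω * (I i ω * u ^ V ω) = p i * ∑ ω, w ω * u ^ V ω := by
      have h := IndepFun.integral_mul_eq_mul_integral (X := I i) (Y := fun ω => u ^ V ω)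
        ((hind i hi).comp measurable_id (measurable_of_countable (fun v : ℕ => u ^ v)))
        AEStronglyMeasurable.of_discrete AEStronglyMeasurable.of_discrete
      rw [integral_fintype Integrable.of_finite, integral_fintype Integrable.of_finite,
        integral_fintype Integrable.of_finite] at h
      simpa [hpI, hw] using h
    have hsplit : ∀ ω, (W ω) = V ω + countOccurring A (s.filter fun j => N i j) ω := by
      intro ω
      simp only [hW, hV, countOccurring, Finset.filter_filter]
      rw [← Finset.card_filter_add_card_filter_not (s := s.filter fun j => ω ∈ A j) fun j => N i j,
        Finset.filter_filter, Finset.filter_filter, add_comm]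
      simp only [and_comm]
    have hsplit' : ∀ ω ∈ A i, W ω - 1 =
        V ω + countOccurring A (s.filter fun j => j ≠ i ∧ N i j) ω := by
      intro ω hω
      have : countOccurring A (s.filter fun j => N i j) ω =
          countOccurring A (s.filter fun j => j ≠ i ∧ N i j) ω + 1 := by
        simp only [countOccurring]
        rw [← Finset.card_erase_add_one (a := i) (by simp [hi, hN i hi, hω])]
        congr 2
        ext j
        simp only [Finset.mem_erase, Finset.mem_filter]
        tauto
      rw [hsplit, this]
      omega
    have hdecomp : ∑ ω, w ω * (I i ω * u ^ (W ω - 1)) - p i * ∑ ω, w ω * u ^ W ω =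
        p i * ∑ ω, w ω * (u ^ V ω - u ^ W ω) +
          ∑ ω, w ω * (I i ω * (u ^ (W ω - 1) - u ^ V ω)) := by
      simp only [mul_sub, Finset.sum_sub_distrib, hfac]
      ring
    rw [hdecomp]
    refine (norm_add_le _ _).trans (add_le_add ?_ ?_)
    · rw [norm_mul, norm_of_nonneg (hp0 i), ← Finset.mul_sum]
      refine mul_le_mul_of_nonneg_left ?_ (hp0 i)
      simp only [hpI]
      rw [Finset.sum_comm]
      refine (norm_sum_le _ _).trans (Finset.sum_le_sum fun ω _ => ?_)
      rw [norm_mul, norm_of_nonneg (hw0 ω), ← Finset.mul_sum,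
        ← countOccurring_eq_sum_indicator, hsplit, norm_sub_rev]
      exact mul_le_mul_of_nonneg_left (pow_sub_pow_add_le hu0 hu1 _ _) (hw0 ω)
    · have hinter : ∀ j, μ.real (A i ∩ A j) = ∑ ω, w ω * (I i ω * I j ω) := by
        intro j
        rw [measureReal_eq_sum_indicator]
        refine Finset.sum_congr rfl fun ω _ => ?_
        rw [Set.inter_indicator_one]
        rfl
      simp only [hinter]
      rw [Finset.sum_comm]
      refine (norm_sum_le _ _).trans (Finset.sum_le_sum fun ω _ => ?_)
      rw [norm_mul, norm_of_nonneg (hw0 ω), ← Finset.mul_sum, ← Finset.mul_sum,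
        ← countOccurring_eq_sum_indicator, norm_mul, norm_of_nonneg (hI0 i ω)]
      refine mul_le_mul_of_nonneg_left ?_ (hw0 ω)
      by_cases hω : ω ∈ A i
      · refine mul_le_mul_of_nonneg_left ?_ (hI0 i ω)
        rw [hsplit' ω hω]
        exact pow_sub_pow_add_le hu0 hu1 _ _
      · simp [hI, hω]
  have hmvt := Convex.norm_image_sub_le_of_norm_hasDerivWithin_le
    (fun u _ => (hderiv u).hasDerivWithinAt) hbound (convex_Icc 0 1)
    (Set.right_mem_Icc.2 zero_le_one) (Set.left_mem_Icc.2 zero_le_one)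
  have h0 : ∑ ω, w ω * (0 : ℝ) ^ W ω = μ.real {ω | ∀ i ∈ s, ω ∉ A i} := by
    rw [measureReal_eq_sum_indicator]
    refine Finset.sum_congr rfl fun ω _ => ?_
    simp only [Set.indicator_apply, zero_pow_eq, hW, countOccurring, Finset.card_eq_zero,
      Finset.filter_eq_empty_iff, Set.mem_ofPred_eq, Pi.one_apply, hw]
  simpa [h0, hw1] using hmvt

end ChenStein

section Estimates

lemma f_eq (n k : ℕ) : f n k = n.choose k / 2 ^ k.choose 2 := by
  rw [f, zpow_neg, zpow_natCast, div_eq_mul_inv]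

lemma f_nonneg (n k : ℕ) : 0 ≤ f n k := by rw [f_eq]; positivity

lemma f_zero (n : ℕ) : f n 0 = 1 := by simp [f_eq]

lemma f_eq_zero_of_lt {n k : ℕ} (h : n < k) : f n k = 0 := by
  simp [f_eq, Nat.choose_eq_zero_of_lt h]

lemma bddAbove_one_le_f (n : ℕ) : BddAbove {k | 1 ≤ f n k} := by
  refine ⟨n, fun k hk => ?_⟩
  by_contra! h
  have hk' : 1 ≤ f n k := hk
  rw [f_eq_zero_of_lt h] at hk'
  linarith

lemma one_le_f_k0 (n : ℕ) : 1 ≤ f n (k0 n) :=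
  Nat.sSup_mem (s := {k | 1 ≤ f n k}) ⟨0, (f_zero n).ge⟩ (bddAbove_one_le_f n)

lemma f_k0_succ_lt_one (n : ℕ) : f n (k0 n + 1) < 1 := by
  by_contra! h
  have := le_csSup (bddAbove_one_le_f n) (a := k0 n + 1) h
  rw [← k0] at this
  omega

lemma two_mul_choose_two (k : ℕ) : k.choose 2 * 2 = k * (k - 1) := by
  rw [Nat.choose_two_right, Nat.div_mul_cancel (Nat.even_mul_pred_self k).two_dvd]

lemma choose_two_succ (k : ℕ) : (k + 1).choose 2 = k.choose 2 + k := by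
  rw [Nat.choose_succ_succ' k 1, Nat.choose_one_right, add_comm]

lemma f_succ_mul (n i : ℕ) : f n (i + 1) * ((i + 1) * 2 ^ i) = f n i * (n - i) := by
  rcases lt_or_ge n i with h | h
  · rw [f_eq_zero_of_lt h, f_eq_zero_of_lt (h.trans (Nat.lt_succ_self i))]; simp
  · have := Nat.choose_succ_right_eq n i
    have h' : (n.choose (i + 1) : ℝ) * (i + 1) = n.choose i * (n - i) := by
      rw [← Nat.cast_sub h]; exact_mod_cast this
    rw [f_eq, f_eq, choose_two_succ, pow_add]
    field_simp
    linarith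

lemma div_pow_le_choose {n r : ℕ} (h : r ≤ n) : ((n : ℝ) / r) ^ r ≤ n.choose r := by
  induction r generalizing n with
  | zero => simp
  | succ r ih =>
    obtain ⟨m, rfl⟩ : ∃ m, n = m + 1 := ⟨n - 1, by omega⟩
    have hrm : r ≤ m := by omega
    have h1 : ((m : ℝ) + 1) * m.choose r = (m + 1).choose (r + 1) * (r + 1) := by
      exact_mod_cast Nat.add_one_mul_choose_eq m r
    have h2 : (((m : ℝ) + 1) / (r + 1)) ^ r ≤ ((m : ℝ) / r) ^ r := by
      rcases Nat.eq_zero_or_pos r with rfl | hr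
      · simp
      · have : (r : ℝ) ≤ m := by exact_mod_cast hrm
        have : (0 : ℝ) < r := by exact_mod_cast hr
        refine pow_le_pow_left₀ (by positivity) ?_ _
        rw [div_le_div_iff₀ (by positivity) (by positivity)]
        nlinarith
    have h3 : (((m + 1).choose (r + 1) : ℕ) : ℝ) = ((m : ℝ) + 1) / (r + 1) * m.choose r := by
      field_simp; linarith
    rw [h3, pow_succ', Nat.cast_succ, Nat.cast_succ]
    exact mul_le_mul_of_nonneg_left (h2.trans (ih hrm)) (by positivity)

lemma div_pow_le_f_sq {n i : ℕ} (h : i ≤ n) :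
    (((n : ℝ) / i) ^ 2 / 2 ^ (i - 1)) ^ i ≤ f n i ^ 2 := by
  have h1 := pow_le_pow_left₀ (by positivity) (div_pow_le_choose h) 2
  rw [f_eq, div_pow, div_pow (n.choose i : ℝ), ← pow_mul (2 : ℝ), ← pow_mul (2 : ℝ),
    two_mul_choose_two, mul_comm i (i - 1), pow_right_comm]
  gcongr

lemma two_pow_pred_le_sq {n k : ℕ} (hk : k ≠ 0) (h : 1 ≤ f n k) : (2 : ℝ) ^ (k - 1) ≤ n ^ 2 := by
  rw [f_eq, one_le_div (by positivity)] at h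
  have h1 : (n.choose k : ℝ) ≤ n ^ k := by exact_mod_cast Nat.choose_le_pow n k
  have h2 := pow_le_pow_left₀ (by positivity) (h.trans h1) 2
  rw [← pow_mul, two_mul_choose_two, mul_comm k, pow_mul, pow_right_comm (n : ℝ)] at h2
  exact le_of_pow_le_pow_left₀ hk (by positivity) h2

lemma sq_lt_of_f_succ_lt_one {n k : ℕ} (hk : k + 1 ≤ n) (h : f n (k + 1) < 1) :
    (n : ℝ) ^ 2 < (k + 1) ^ 2 * 2 ^ k := by
  have h1 := div_pow_le_f_sq hk
  have h2 : f n (k + 1) ^ 2 < 1 := by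
    have := f_nonneg n (k + 1)
    nlinarith
  have h3 := lt_of_pow_lt_pow_left₀ _ zero_le_one ((h1.trans_lt h2).trans_eq (one_pow _).symm)
  rw [div_lt_one (by positivity), div_pow, div_lt_iff₀ (by positivity)] at h3
  push_cast at h3
  linarith

/-- The range of `n`, `k` in which independent sets of size `k` appear in `G(n,1/2)` while
those of size `k + 1` do not. -/
structure IsThreshold (n k : ℕ) : Prop where
  pos : k ≠ 0
  two_mul_le : 2 * (k + 2) ≤ n
  one_le_f : 1 ≤ f n k
  two_pow_le : (2 : ℝ) ^ (k - 1) ≤ n ^ 2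
  sq_le : (n : ℝ) ^ 2 ≤ (k + 1) ^ 2 * 2 ^ k

variable {n k i : ℕ}

lemma IsThreshold.pow_le_f_of_le (h : IsThreshold n k) (hi0 : i ≠ 0) (hi : i + 2 * (k / 6) ≤ k) :
    ((2 : ℝ) ^ (k / 6) / (k + 2)) ^ i ≤ f n i := by
  have hn := h.two_mul_le
  refine le_of_sq_le_sq ?_ (f_nonneg n i)
  refine le_trans ?_ (div_pow_le_f_sq (by omega))
  rw [← pow_mul, mul_comm, pow_mul]
  refine pow_le_pow_left₀ (by positivity) ?_ i
  have hi0' : (0 : ℝ) < i := by positivity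
  rw [div_pow, div_pow, div_div, div_le_div_iff₀ (by positivity) (by positivity)]
  have h1 : (i : ℝ) ≤ k + 2 := by exact_mod_cast (by omega : i ≤ k + 2)
  have h2 : (2 : ℝ) ^ (i - 1) * (2 ^ (k / 6)) ^ 2 ≤ n ^ 2 := by
    refine le_trans ?_ h.two_pow_le
    rw [← pow_mul, ← pow_add]
    exact pow_le_pow_right₀ one_le_two (by omega)
  calc ((2 : ℝ) ^ (k / 6)) ^ 2 * ((i : ℝ) ^ 2 * 2 ^ (i - 1))
      = (2 ^ (i - 1) * (2 ^ (k / 6)) ^ 2) * i ^ 2 := by ring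
    _ ≤ (n : ℝ) ^ 2 * ((k : ℝ) + 2) ^ 2 := by gcongr

lemma IsThreshold.pow_le_f_of_ge (h : IsThreshold n k) (hik : i ≤ k)
    (hi : k ≤ i + 2 * (k / 6)) :
    ((2 : ℝ) ^ (k / 6) / (k + 2)) ^ (k - i) ≤ f n i := by
  have hn := h.two_mul_le
  have hn0 : (0 : ℝ) < n := by exact_mod_cast (by omega : 0 < n)
  induction hik using Nat.decreasingInduction with
  | self => simpa using h.one_le_f
  | of_succ i hlt ih =>
    have ih := ih (by omega)
    have h1 := f_succ_mul n i
    have h2 : (2 : ℝ) ^ (k / 6) * n ≤ (k + 2) * 2 ^ i := by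
      refine le_of_sq_le_sq ?_ (by positivity)
      rw [mul_pow, mul_pow]
      calc ((2 : ℝ) ^ (k / 6)) ^ 2 * (n : ℝ) ^ 2
          ≤ (2 ^ (k / 6)) ^ 2 * (((k : ℝ) + 1) ^ 2 * 2 ^ k) := by
            gcongr; exact h.sq_le
        _ = ((k : ℝ) + 1) ^ 2 * 2 ^ ((k / 6) * 2 + k) := by rw [pow_add, pow_mul]; ring
        _ ≤ ((k : ℝ) + 2) ^ 2 * 2 ^ (i * 2) := by
            gcongr
            · linarith
            · norm_num
            · omega
        _ = _ := by rw [pow_mul]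
    rw [show k - i = (k - (i + 1)) + 1 by omega, pow_succ]
    have h3 : f n (i + 1) * (2 ^ i / n) ≤ f n i := by
      rw [← mul_div_assoc, div_le_iff₀ hn0]
      have e1 : f n (i + 1) * 2 ^ i * 1 ≤ f n (i + 1) * 2 ^ i * (i + 1) :=
        mul_le_mul_of_nonneg_left (by linarith [(Nat.cast_nonneg i : (0 : ℝ) ≤ i)])
          (mul_nonneg (f_nonneg _ _) (by positivity))
      nlinarith [mul_nonneg (f_nonneg n i) (Nat.cast_nonneg i : (0 : ℝ) ≤ i)]
    refine le_trans ?_ h3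
    refine mul_le_mul ih ?_ (by positivity) (f_nonneg _ _)
    rw [div_le_div_iff₀ (by positivity) hn0]
    linarith

lemma choose_le_pow_of_le {a K : ℕ} (h : a ≤ K) (i : ℕ) : (a.choose i : ℝ) ≤ (K : ℝ) ^ i := by
  exact_mod_cast (Nat.choose_le_pow a i).trans (Nat.pow_le_pow_left h i)

lemma IsThreshold.choose_sq_le_of_le (h : IsThreshold n k)
    (hk : ((k : ℝ) + 2) ^ 3 ≤ 2 ^ (k / 6)) (hi0 : i ≠ 0) (hi : i + 2 * (k / 6) ≤ k)
    {a : ℕ} (ha : a ≤ k + 2) :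
    (a.choose i : ℝ) ^ 2 ≤ (k + 2) ^ 3 / 2 ^ (k / 6) * f n i := by
  set m := k / 6
  have h1 := choose_le_pow_of_le ha i
  push_cast at h1
  calc (a.choose i : ℝ) ^ 2 ≤ (((k : ℝ) + 2) ^ i) ^ 2 := by gcongr
    _ = (((k : ℝ) + 2) ^ 3 / 2 ^ m) ^ i * (2 ^ m / (k + 2)) ^ i := by
        rw [← mul_pow, ← pow_mul, mul_comm i, pow_mul]
        congr 1
        field_simp
    _ ≤ (k + 2) ^ 3 / 2 ^ m * f n i := by
        refine mul_le_mul ?_ (h.pow_le_f_of_le hi0 hi) (by positivity) (by positivity)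
        exact pow_le_of_le_one (by positivity) ((div_le_one (by positivity)).2 hk) hi0

lemma IsThreshold.pow_le_of_ge (h : IsThreshold n k) (hik : i ≤ k) (hi : k ≤ i + 2 * (k / 6)) :
    (((k : ℝ) + 2) ^ (k - i)) ^ 2 ≤ ((k + 2) ^ 3 / 2 ^ (k / 6)) ^ (k - i) * f n i := by
  calc (((k : ℝ) + 2) ^ (k - i)) ^ 2
      = (((k : ℝ) + 2) ^ 3 / 2 ^ (k / 6)) ^ (k - i) * (2 ^ (k / 6) / (k + 2)) ^ (k - i) := by
        rw [← mul_pow, ← pow_mul, mul_comm (k - i), pow_mul]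
        congr 1
        field_simp
    _ ≤ _ := by gcongr; exact h.pow_le_f_of_ge hik hi

lemma IsThreshold.choose_sq_le (h : IsThreshold n k) (hk : ((k : ℝ) + 2) ^ 3 ≤ 2 ^ (k / 6))
    (hi0 : i ≠ 0) (hik : i < k) :
    (k.choose i : ℝ) ^ 2 ≤ (k + 2) ^ 3 / 2 ^ (k / 6) * f n i := by
  rcases le_total (i + 2 * (k / 6)) k with hi | hi
  · exact h.choose_sq_le_of_le hk hi0 hi (by omega)
  · have h1 := choose_le_pow_of_le (by omega : k ≤ k + 2) (k - i)
    rw [Nat.choose_symm hik.le] at h1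
    push_cast at h1
    refine (pow_le_pow_left₀ (by positivity) h1 2).trans ?_
    refine (h.pow_le_of_ge hik.le hi).trans ?_
    refine mul_le_mul_of_nonneg_right ?_ (f_nonneg _ _)
    exact pow_le_of_le_one (by positivity) ((div_le_one (by positivity)).2 hk) (by omega)

lemma IsThreshold.two_pow_le_n (h : IsThreshold n k) : (2 : ℝ) ^ (k / 6) ≤ n := by
  refine le_of_sq_le_sq ?_ (by positivity)
  refine le_trans ?_ h.two_pow_le
  have := h.pos
  rw [← pow_mul]
  exact pow_le_pow_right₀ one_le_two (by omega)

lemma IsThreshold.choose_add_two_sq_le (h : IsThreshold n k)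
    (hk : ((k : ℝ) + 2) ^ 3 ≤ 2 ^ (k / 6)) (hi0 : i ≠ 0) (hik : i ≤ k + 1) :
    ((k + 2).choose i : ℝ) ^ 2 / 2 ^ i ≤ (k + 2) ^ 4 / 2 ^ (k / 6) * f n i := by
  rw [div_le_iff₀ (by positivity)]
  rcases hik.eq_or_lt with rfl | hik'
  · have h1 := f_succ_mul n k
    have h2 : (k + 2).choose (k + 1) = k + 2 := by
      rw [← Nat.choose_symm_of_eq_add (by omega : k + 2 = 1 + (k + 1)), Nat.choose_one_right]
    have h3 := h.two_pow_le_n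
    have h4 : (2 : ℝ) * (k + 2) ≤ n := by exact_mod_cast h.two_mul_le
    have h5 : (n : ℝ) - k ≤ f n k * (n - k) :=
      le_mul_of_one_le_left (by linarith) h.one_le_f
    have h6 : (n : ℝ) ≤ 2 * (f n (k + 1) * ((k + 1) * 2 ^ k)) := by linarith
    have h7 := f_nonneg n (k + 1)
    rw [h2]
    push_cast
    rw [div_mul_eq_mul_div, div_mul_eq_mul_div, le_div_iff₀ (by positivity)]
    calc ((k : ℝ) + 2) ^ 2 * 2 ^ (k / 6)
        ≤ (k + 2) ^ 2 * (2 * (f n (k + 1) * ((k + 1) * 2 ^ k))) := by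
          gcongr; linarith
      _ = (k + 2) ^ 2 * (k + 1) * 1 * (f n (k + 1) * 2 ^ (k + 1)) := by ring
      _ ≤ (k + 2) ^ 2 * (k + 2) * (k + 2) * (f n (k + 1) * 2 ^ (k + 1)) := by
          gcongr <;> linarith [(Nat.cast_nonneg k : (0 : ℝ) ≤ k)]
      _ = (k + 2) ^ 4 * f n (k + 1) * 2 ^ (k + 1) := by ring
  have hik : i ≤ k := by omega
  have hf := f_nonneg n i
  rcases le_total (i + 2 * (k / 6)) k with hi | hi
  · refine (h.choose_sq_le_of_le hk hi0 hi le_rfl).trans ?_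
    have : (k + 2 : ℝ) ^ 3 ≤ (k + 2) ^ 4 :=
      pow_le_pow_right₀ (by linarith [(Nat.cast_nonneg k : (0 : ℝ) ≤ k)]) (by norm_num)
    calc ((k : ℝ) + 2) ^ 3 / 2 ^ (k / 6) * f n i ≤ (k + 2) ^ 4 / 2 ^ (k / 6) * f n i := by gcongr
      _ ≤ _ := le_mul_of_one_le_right (by positivity) (one_le_pow₀ one_le_two)
  · have h1 := choose_le_pow_of_le (le_refl (k + 2)) (k + 2 - i)
    rw [Nat.choose_symm (by omega)] at h1
    push_cast at h1
    have h2 : (2 : ℝ) ^ (k / 6) ≤ 2 ^ i := pow_le_pow_right₀ one_le_two (by omega)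
    have h3 := h.pow_le_of_ge hik hi
    have h4 : (((k : ℝ) + 2) ^ 3 / 2 ^ (k / 6)) ^ (k - i) ≤ 1 :=
      pow_le_one₀ (by positivity) ((div_le_one (by positivity)).2 hk)
    calc ((k + 2).choose i : ℝ) ^ 2 ≤ (((k : ℝ) + 2) ^ (k + 2 - i)) ^ 2 := by gcongr
      _ = (k + 2) ^ 4 * (((k : ℝ) + 2) ^ (k - i)) ^ 2 := by
          rw [show k + 2 - i = 2 + (k - i) by omega, pow_add]; ring
      _ ≤ (k + 2) ^ 4 * (1 * f n i) := by
          gcongr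
          exact h3.trans (by gcongr)
      _ ≤ (k + 2) ^ 4 * ((2 ^ i / 2 ^ (k / 6)) * f n i) := by
          gcongr
          rwa [one_le_div (by positivity)]
      _ = _ := by ring

lemma g_eq (n k : ℕ) : g n k = f n (k + 2) * (2 ^ (k + 1) - 1) := by
  rw [g, f]; ring

lemma IsThreshold.g_le (h : IsThreshold n k) : g n k ≤ f n k := by
  have h1 := f_succ_mul n k
  have h2 := f_succ_mul n (k + 1)
  have h3 := h.sq_le
  have hn : (2 : ℝ) * (k + 2) ≤ n := by exact_mod_cast h.two_mul_le
  have hk := (Nat.cast_nonneg k : (0 : ℝ) ≤ k)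
  have f2 := f_nonneg n (k + 2)
  have f0 := f_nonneg n k
  push_cast at h2
  have h4 : f n (k + 2) * ((k + 1) ^ 2 * 2 ^ k * 2 ^ (k + 1)) ≤ f n k * n ^ 2 := by
    calc f n (k + 2) * ((k + 1) ^ 2 * 2 ^ k * 2 ^ (k + 1))
        ≤ f n (k + 2) * ((k + 1) * (k + 1 + 1) * 2 ^ k * 2 ^ (k + 1)) := by
          gcongr
          nlinarith
      _ = f n (k + 1 + 1) * ((k + 1 + 1) * 2 ^ (k + 1)) * ((k + 1) * 2 ^ k) := by ring_nf
      _ = f n (k + 1) * ((k + 1) * 2 ^ k) * (n - (k + 1)) := by rw [h2]; ring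
      _ = f n k * ((n - k) * (n - (k + 1))) := by rw [h1]; ring
      _ ≤ f n k * n ^ 2 := by
          gcongr
          nlinarith
  have hpos : (0 : ℝ) < (k + 1) ^ 2 * 2 ^ k := by positivity
  rw [g_eq]
  refine le_of_mul_le_mul_right ?_ hpos
  calc f n (k + 2) * (2 ^ (k + 1) - 1) * ((k + 1) ^ 2 * 2 ^ k)
      ≤ f n (k + 2) * 2 ^ (k + 1) * ((k + 1) ^ 2 * 2 ^ k) := by
        gcongr; linarith
    _ ≤ f n k * n ^ 2 := by linarith
    _ ≤ _ := by gcongr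

end Estimates

section Patterns

instance : IsProbabilityMeasure (bernoulliBool (1 / 2)) := by
  refine ⟨?_⟩
  have h : (1 / 2 : ℝ).toNNReal + (1 - 1 / 2 : ℝ).toNNReal = 1 := by
    rw [← Real.toNNReal_add (by norm_num) (by norm_num)]; norm_num
  simp only [bernoulliBool, Measure.coe_add, Pi.add_apply, Measure.smul_apply, measure_univ]
  simpa [ENNReal.smul_def] using congrArg ((↑) : NNReal → ENNReal) h

instance (n : ℕ) : IsProbabilityMeasure (erdosRenyi n (1 / 2)) := by
  unfold erdosRenyi; infer_instance

lemma bernoulliBool_half_singleton (b : Bool) : (bernoulliBool (1 / 2)).real {b} = 1 / 2 := by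
  have h : (1 - 1 / 2 : ℝ) = 1 / 2 := by norm_num
  have h2 : ((1 / 2 : ℝ).toNNReal : ℝ) = 1 / 2 := Real.coe_toNNReal _ (by norm_num)
  rw [bernoulliBool, h, measureReal_add_apply, measureReal_nnreal_smul_apply,
    measureReal_nnreal_smul_apply, h2]
  cases b <;> simp [measureReal_def, -one_div]

lemma erdosRenyi_half_cylinder (n : ℕ) (D : Finset (Sym2 (Fin n))) (φ : Sym2 (Fin n) → Bool) :
    (erdosRenyi n (1 / 2)).real {ω | ∀ e ∈ D, ω e = φ e} = (1 / 2) ^ D.card := by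
  have h : {ω : Sym2 (Fin n) → Bool | ∀ e ∈ D, ω e = φ e} = (D : Set _).pi fun e => {φ e} := by
    ext ω; simp
  rw [h, measureReal_def, erdosRenyi, Measure.pi_pi_finset, ENNReal.toReal_prod]
  simp_rw [← measureReal_def, bernoulliBool_half_singleton, Finset.prod_const]

lemma indepFun_of_dependsOn {n : ℕ} {β γ : Type*} [MeasurableSpace β] [MeasurableSpace γ]
    {F : (Sym2 (Fin n) → Bool) → β} {G : (Sym2 (Fin n) → Bool) → γ} {D : Finset (Sym2 (Fin n))}
    (hF : DependsOn F (D : Set (Sym2 (Fin n)))) (hG : DependsOn G (D : Set (Sym2 (Fin n)))ᶜ) :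
    IndepFun F G (erdosRenyi n (1 / 2)) := by
  classical
  have h : iIndepFun (fun (e : Sym2 (Fin n)) (ω : Sym2 (Fin n) → Bool) => ω e)
      (erdosRenyi n (1 / 2)) :=
    iIndepFun_pi (X := fun _ => id) fun _ => aemeasurable_id
  have h2 := h.indepFun_finset D Dᶜ disjoint_compl_right fun e => measurable_pi_apply e
  let ext (E : Finset (Sym2 (Fin n))) (x : E → Bool) : Sym2 (Fin n) → Bool :=
    fun e => if he : e ∈ E then x ⟨e, he⟩ else false
  have h3 := h2.comp (φ := fun x => F (ext D x)) (ψ := fun x => G (ext Dᶜ x))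
    (measurable_of_countable _) (measurable_of_countable _)
  convert h3 using 1
  · ext ω
    refine hF fun e he => ?_
    simp [ext, Finset.mem_coe.1 he]
  · ext ω
    refine hG fun e he => ?_
    have he' : e ∉ D := he
    simp [ext, he']

variable {n : ℕ}

/-- The pairs of distinct elements of `T`. -/
def edgesOn (T : Finset (Fin n)) : Finset (Sym2 (Fin n)) :=
  T.offDiag.image (Function.uncurry Sym2.mk)

lemma mk_mem_edgesOn {T : Finset (Fin n)} {u v : Fin n} :
    s(u, v) ∈ edgesOn T ↔ u ∈ T ∧ v ∈ T ∧ u ≠ v := by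
  simp only [edgesOn, Finset.mem_image, Finset.mem_offDiag, Prod.exists,
    Function.uncurry_apply_pair, Sym2.eq_iff]
  constructor
  · rintro ⟨a, b, ⟨ha, hb, hab⟩, ⟨rfl, rfl⟩ | ⟨rfl, rfl⟩⟩
    · exact ⟨ha, hb, hab⟩
    · exact ⟨hb, ha, hab.symm⟩
  · rintro h
    exact ⟨u, v, h, Or.inl ⟨rfl, rfl⟩⟩

lemma card_edgesOn (T : Finset (Fin n)) : (edgesOn T).card = T.card.choose 2 :=
  Sym2.card_image_offDiag T

lemma edgesOn_inter (S T : Finset (Fin n)) : edgesOn S ∩ edgesOn T = edgesOn (S ∩ T) := by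
  ext e
  induction e using Sym2.ind with
  | _ u v =>
    simp only [Finset.mem_inter, mk_mem_edgesOn]
    tauto

/-- The event that the graph induced on `p.1` is complete bipartite with vertex classes
`p.1 \ p.2` and `p.1 ∩ p.2`, one of which may be empty. -/
def occurs (p : Σ _ : Finset (Fin n), Finset (Fin n)) : Set (Sym2 (Fin n) → Bool) :=
  {ω | ∀ u ∈ p.1, ∀ v ∈ p.1, u ≠ v → (ω s(u, v) = true ↔ ¬(u ∈ p.2 ↔ v ∈ p.2))}

variable {p q : Σ _ : Finset (Fin n), Finset (Fin n)}

lemma mem_occurs_iff_of_mem {ω₀ ω : Sym2 (Fin n) → Bool} (h₀ : ω₀ ∈ occurs p) :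
    ω ∈ occurs p ↔ ∀ e ∈ edgesOn p.1, ω e = ω₀ e := by
  constructor
  · intro h e
    induction e using Sym2.ind with
    | _ u v =>
      intro he
      obtain ⟨hu, hv, huv⟩ := mk_mem_edgesOn.1 he
      rw [Bool.eq_iff_iff, h u hu v hv huv, h₀ u hu v hv huv]
  · intro h u hu v hv huv
    rw [h _ (mk_mem_edgesOn.2 ⟨hu, hv, huv⟩), h₀ u hu v hv huv]

lemma dependsOn_mem_occurs (p : Σ _ : Finset (Fin n), Finset (Fin n)) :
    DependsOn (fun ω => ω ∈ occurs p) (edgesOn p.1 : Set (Sym2 (Fin n))) := by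
  intro ω ω' h
  have : ∀ u ∈ p.1, ∀ v ∈ p.1, u ≠ v → ω s(u, v) = ω' s(u, v) := fun u hu v hv huv =>
    h _ (Finset.mem_coe.2 (mk_mem_edgesOn.2 ⟨hu, hv, huv⟩))
  refine propext (forall₂_congr fun u hu => forall₂_congr fun v hv => forall_congr' fun huv => ?_)
  rw [this u hu v hv huv]

lemma occurs_nonempty (p : Σ _ : Finset (Fin n), Finset (Fin n)) : (occurs p).Nonempty := by
  classical
  refine ⟨fun e => decide (∃ u ∈ p.2, ∃ v ∉ p.2, e = s(u, v)), fun u _ v _ _ => ?_⟩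
  simp only [decide_eq_true_eq, Sym2.eq_iff]
  constructor
  · rintro ⟨a, ha, b, hb, ⟨rfl, rfl⟩ | ⟨rfl, rfl⟩⟩ <;> tauto
  · intro h
    by_cases hu : u ∈ p.2
    · exact ⟨u, hu, v, by tauto, by tauto⟩
    · exact ⟨v, by tauto, u, hu, by tauto⟩

lemma measureReal_occurs (p : Σ _ : Finset (Fin n), Finset (Fin n)) :
    (erdosRenyi n (1 / 2)).real (occurs p) = 1 / 2 ^ p.1.card.choose 2 := by
  obtain ⟨ω₀, h₀⟩ := occurs_nonempty p
  have : occurs p = {ω | ∀ e ∈ edgesOn p.1, ω e = ω₀ e} :=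
    Set.ext fun ω => mem_occurs_iff_of_mem h₀
  rw [this, erdosRenyi_half_cylinder, card_edgesOn, one_div_pow]

lemma measureReal_occurs_inter_le (p q : Σ _ : Finset (Fin n), Finset (Fin n)) :
    (erdosRenyi n (1 / 2)).real (occurs p ∩ occurs q) ≤
      2 ^ (p.1 ∩ q.1).card.choose 2 / (2 ^ p.1.card.choose 2 * 2 ^ q.1.card.choose 2) := by
  rcases (occurs p ∩ occurs q).eq_empty_or_nonempty with h | ⟨ω₀, hp, hq⟩
  · rw [h, measureReal_empty]; positivity
  · have : occurs p ∩ occurs q = {ω | ∀ e ∈ edgesOn p.1 ∪ edgesOn q.1, ω e = ω₀ e} := by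
      ext ω
      rw [Set.mem_inter_iff, mem_occurs_iff_of_mem hp, mem_occurs_iff_of_mem hq]
      simp only [Finset.mem_union, or_imp, forall_and, Set.mem_ofPred_eq]
    have hc := Finset.card_union_add_card_inter (edgesOn p.1) (edgesOn q.1)
    rw [edgesOn_inter, card_edgesOn, card_edgesOn, card_edgesOn] at hc
    rw [this, erdosRenyi_half_cylinder, ← pow_add, ← hc, pow_add, one_div_pow]
    refine le_of_eq ?_
    field_simp

lemma consistent_of_mem_occurs {ω : Sym2 (Fin n) → Bool} (hp : ω ∈ occurs p) (hq : ω ∈ occurs q) :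
    q.2 ∩ (p.1 ∩ q.1) = p.2 ∩ (p.1 ∩ q.1) ∨ q.2 ∩ (p.1 ∩ q.1) = (p.1 ∩ q.1) \ p.2 := by
  have key : ∀ u ∈ p.1 ∩ q.1, ∀ v ∈ p.1 ∩ q.1,
      ((u ∈ p.2 ↔ u ∈ q.2) ↔ (v ∈ p.2 ↔ v ∈ q.2)) := by
    intro u hu v hv
    rw [Finset.mem_inter] at hu hv
    rcases eq_or_ne u v with rfl | huv
    · exact Iff.rfl
    · have h1 := hp u hu.1 v hv.1 huv
      have h2 := hq u hu.2 v hv.2 huv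
      tauto
  by_cases h : ∃ u ∈ p.1 ∩ q.1, (u ∈ p.2 ↔ u ∈ q.2)
  · obtain ⟨u, hu, hu'⟩ := h
    left
    ext v
    rw [Finset.mem_inter, Finset.mem_inter (s₁ := p.2)]
    refine and_congr_left fun hv => ?_
    exact ((key u hu v hv).1 hu').symm
  · right
    push Not at h
    ext v
    rw [Finset.mem_inter, Finset.mem_sdiff, and_comm]
    refine and_congr_right fun hv => ?_
    have := h v hv
    tauto

lemma indepFun_occurs (p : Σ _ : Finset (Fin n), Finset (Fin n))
    (s : Finset (Σ _ : Finset (Fin n), Finset (Fin n)))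
    (hs : ∀ q ∈ s, ¬ 2 ≤ (p.1 ∩ q.1).card) :
    IndepFun ((occurs p).indicator (1 : (Sym2 (Fin n) → Bool) → ℝ)) (countOccurring occurs s)
      (erdosRenyi n (1 / 2)) := by
  classical
  refine indepFun_of_dependsOn (D := edgesOn p.1) ?_ ?_
  · intro ω ω' h
    have := dependsOn_mem_occurs p h
    simp only [eq_iff_iff] at this
    simp only [Set.indicator_apply, this, Pi.one_apply]
  · intro ω ω' h
    unfold countOccurring
    congr 1
    refine Finset.filter_congr fun q hq => ?_
    rw [← eq_iff_iff]
    refine dependsOn_mem_occurs q fun e he => h e fun he' => ?_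
    have h1 := Finset.mem_inter.2 ⟨Finset.mem_coe.1 he', Finset.mem_coe.1 he⟩
    rw [edgesOn_inter] at h1
    have h2 := Finset.card_pos.2 ⟨e, h1⟩
    rw [card_edgesOn, Nat.choose_eq_zero_of_lt (by have := hs q hq; omega)] at h2
    exact absurd h2 (lt_irrefl 0)

/-- The elements of `T` other than its minimum. -/
def nonMin (T : Finset (Fin n)) : Finset (Fin n) := T.filter fun u => ∃ w ∈ T, w < u

lemma exists_nonMin_eq_erase {T : Finset (Fin n)} (h : T.Nonempty) :
    ∃ r ∈ T, nonMin T = T.erase r := by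
  refine ⟨T.min' h, T.min'_mem h, ?_⟩
  ext u
  simp only [nonMin, Finset.mem_filter, Finset.mem_erase]
  constructor
  · rintro ⟨hu, w, hw, hwu⟩
    exact ⟨((T.min'_le w hw).trans_lt hwu).ne', hu⟩
  · rintro ⟨hu, hT⟩
    exact ⟨hT, _, T.min'_mem h, lt_of_le_of_ne (T.min'_le u hT) (Ne.symm hu)⟩

/-- The pairs `⟨T, ∅⟩` with `T` of size `k`; `occurs` says that `T` is independent. -/
def indepPatterns (n k : ℕ) : Finset (Σ _ : Finset (Fin n), Finset (Fin n)) :=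
  (Finset.powersetCard k Finset.univ).sigma fun _ => {∅}

/-- The pairs `⟨T, B⟩` with `T` of size `m` and `B` a nonempty subset of `T` not containing
the minimum of `T`; they enumerate the bipartitions of `T` into two nonempty classes. -/
def bipPatterns (n m : ℕ) : Finset (Σ _ : Finset (Fin n), Finset (Fin n)) :=
  (Finset.powersetCard m Finset.univ).sigma fun T => (nonMin T).powerset.erase ∅

lemma mem_indepPatterns {k : ℕ} : p ∈ indepPatterns n k ↔ p.1.card = k ∧ p.2 = ∅ := by
  simp [indepPatterns, Finset.mem_powersetCard]

lemma mem_bipPatterns {m : ℕ} :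
    p ∈ bipPatterns n m ↔ p.1.card = m ∧ p.2.Nonempty ∧ p.2 ⊆ nonMin p.1 := by
  simp [bipPatterns, Finset.mem_powersetCard, Finset.nonempty_iff_ne_empty]

lemma graphOf_adj {ω : Sym2 (Fin n) → Bool} {u v : Fin n} :
    (graphOf n ω).Adj u v ↔ ω s(u, v) = true ∧ u ≠ v := by
  simp [graphOf]

lemma isIndepFinset_iff {ω : Sym2 (Fin n) → Bool} {S : Finset (Fin n)} :
    IsIndepFinset (graphOf n ω) S ↔ ω ∈ occurs ⟨S, ∅⟩ := by
  simp only [IsIndepFinset, graphOf_adj, occurs, Set.mem_ofPred_eq, Finset.notMem_empty, iff_self,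
    not_true_eq_false, iff_false, Bool.not_eq_true]
  refine forall₂_congr fun u _ => forall₂_congr fun v _ => ?_
  cases ω s(u, v) <;> simp

lemma exists_isInducedCompleteBipartite_iff {ω : Sym2 (Fin n) → Bool} {S : Finset (Fin n)} :
    (∃ A B, IsInducedCompleteBipartite (graphOf n ω) S A B) ↔
      ∃ B : Finset (Fin n), B.Nonempty ∧ B ⊆ nonMin S ∧ ω ∈ occurs ⟨S, B⟩ := by
  have key : ∀ A B r, r ∈ S → nonMin S = S.erase r → r ∉ B →
      IsInducedCompleteBipartite (graphOf n ω) S A B →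
      ∃ B : Finset (Fin n), B.Nonempty ∧ B ⊆ nonMin S ∧ ω ∈ occurs ⟨S, B⟩ := by
    rintro A B r hr hS hrB ⟨hA, hB, hAB, hU, hadj⟩
    have hU' : ∀ x, x ∈ S ↔ x ∈ A ∨ x ∈ B := fun x => by
      rw [← Finset.mem_coe (s := S), ← hU]; simp
    have hd : ∀ x ∈ A, x ∉ B := fun x hx => Finset.disjoint_left.1 hAB hx
    refine ⟨B, hB, ?_, ?_⟩
    · rw [hS]
      intro x hx
      exact Finset.mem_erase.2 ⟨fun h => hrB (h ▸ hx), (hU' x).2 (Or.inr hx)⟩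
    · intro u hu v hv huv
      have h := hadj u hu v hv
      rw [graphOf_adj] at h
      have h1 := hd u
      have h2 := hd v
      have h3 := (hU' u).1 hu
      have h4 := (hU' v).1 hv
      simp only
      tauto
  constructor
  · rintro ⟨A, B, h⟩
    obtain ⟨a, ha⟩ := h.1
    have haS : a ∈ S := by
      rw [← Finset.mem_coe, ← h.2.2.2.1]; exact Or.inl ha
    obtain ⟨r, hr, hS⟩ := exists_nonMin_eq_erase ⟨a, haS⟩
    by_cases hrB : r ∈ B
    · refine key B A r hr hS (Finset.disjoint_right.1 h.2.2.1 hrB)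
        ⟨h.2.1, h.1, h.2.2.1.symm, by rw [Set.union_comm]; exact h.2.2.2.1, fun u hu v hv => ?_⟩
      rw [h.2.2.2.2 u hu v hv]
      exact or_comm
    · exact key A B r hr hS hrB h
  · rintro ⟨B, hB, hBS, hω⟩
    obtain ⟨b, hb⟩ := hB
    have hsub : nonMin S ⊆ S := Finset.filter_subset _ _
    obtain ⟨r, hr, hS⟩ := exists_nonMin_eq_erase ⟨b, hsub (hBS hb)⟩
    have hrB : r ∉ B := fun h => by simpa [hS] using hBS h
    refine ⟨S \ B, B, ⟨r, by simp [hr, hrB]⟩, ⟨b, hb⟩, Finset.sdiff_disjoint, ?_,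
      fun u hu v hv => ?_⟩
    · rw [← Finset.coe_union, Finset.sdiff_union_of_subset (hBS.trans hsub)]
    · rw [graphOf_adj]
      have h := hω u hu v hv
      simp only at h
      simp only [Finset.mem_sdiff, hu, hv, true_and]
      rcases eq_or_ne u v with rfl | huv
      · tauto
      · tauto

lemma none_occurs_iff (k m : ℕ) (ω : Sym2 (Fin n) → Bool) :
    (numIndep n k ω = 0 ∧ numBip n m ω = 0) ↔
      ∀ p ∈ indepPatterns n k ∪ bipPatterns n m, ω ∉ occurs p := by
  rw [numIndep, numBip, Set.ncard_eq_zero, Set.ncard_eq_zero, Set.eq_empty_iff_forall_notMem,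
    Set.eq_empty_iff_forall_notMem]
  simp only [Finset.mem_union, or_imp, forall_and, mem_indepPatterns, mem_bipPatterns,
    Set.mem_ofPred_eq, exists_isInducedCompleteBipartite_iff, isIndepFinset_iff]
  constructor
  · rintro ⟨h1, h2⟩
    refine ⟨?_, ?_⟩
    · rintro ⟨T, B⟩ ⟨hT, hB⟩ hω
      obtain rfl : B = ∅ := hB
      exact h1 T ⟨hT, hω⟩
    · rintro ⟨T, B⟩ ⟨hT, hB, hBT⟩ hω
      exact h2 T ⟨hT, B, hB, hBT, hω⟩
  · rintro ⟨h1, h2⟩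
    exact ⟨fun S ⟨hS, hω⟩ => h1 ⟨S, ∅⟩ ⟨hS, rfl⟩ hω,
      fun S ⟨hS, B, hB, hBS, hω⟩ => h2 ⟨S, B⟩ ⟨hS, hB, hBS⟩ hω⟩

lemma card_indepPatterns (n k : ℕ) : (indepPatterns n k).card = n.choose k := by
  simp [indepPatterns]

lemma card_bipParts {T : Finset (Fin n)} {m : ℕ} (hT : T.card = m + 1) :
    ((nonMin T).powerset.erase ∅).card = 2 ^ m - 1 := by
  obtain ⟨r, hr, h⟩ := exists_nonMin_eq_erase (Finset.card_pos.1 (by omega : 0 < T.card))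
  rw [Finset.card_erase_of_mem (by simp), Finset.card_powerset, h, Finset.card_erase_of_mem hr, hT]
  simp

lemma card_bipPatterns (n m : ℕ) :
    (bipPatterns n (m + 1)).card = n.choose (m + 1) * (2 ^ m - 1) := by
  rw [bipPatterns, Finset.card_sigma, Finset.sum_congr rfl fun T hT =>
    card_bipParts (Finset.mem_powersetCard.1 hT).2]
  simp

lemma sum_measureReal_indepPatterns (n k : ℕ) :
    ∑ p ∈ indepPatterns n k, (erdosRenyi n (1 / 2)).real (occurs p) = f n k := by
  rw [Finset.sum_congr rfl fun p hp => by
    rw [measureReal_occurs, (mem_indepPatterns.1 hp).1]]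
  rw [Finset.sum_const, card_indepPatterns, f_eq, nsmul_eq_mul, mul_one_div]

lemma sum_measureReal_bipPatterns (n k : ℕ) :
    ∑ p ∈ bipPatterns n (k + 2), (erdosRenyi n (1 / 2)).real (occurs p) = g n k := by
  rw [Finset.sum_congr rfl fun p hp => by
    rw [measureReal_occurs, (mem_bipPatterns.1 hp).1]]
  rw [Finset.sum_const, card_bipPatterns, g_eq, f_eq, nsmul_eq_mul, mul_one_div, Nat.cast_mul,
    Nat.cast_sub Nat.one_le_two_pow]
  push_cast
  ring

end Patterns

section Counting

variable {n : ℕ} {p : Σ _ : Finset (Fin n), Finset (Fin n)}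

lemma card_le_card_inter_le (T : Finset (Fin n)) (b i : ℕ) :
    ((Finset.powersetCard b Finset.univ).filter fun T' : Finset (Fin n) =>
      i ≤ (T ∩ T').card).card ≤ T.card.choose i * (n - i).choose (b - i) := by
  rcases lt_or_ge b i with hb | hb
  · rw [Finset.filter_false_of_mem, Finset.card_empty]
    · exact Nat.zero_le _
    · intro T' hT' h
      have := Finset.card_le_card (Finset.inter_subset_right (s₁ := T) (s₂ := T'))
      rw [(Finset.mem_powersetCard.1 hT').2] at this
      omega
  have hsub : ((Finset.powersetCard b Finset.univ).filter fun T' : Finset (Fin n) =>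
      i ≤ (T ∩ T').card) ⊆ (Finset.powersetCard i T).biUnion fun U =>
        (Finset.powersetCard b Finset.univ).filter fun T' => U ⊆ T' := by
    intro T' hT'
    rw [Finset.mem_filter] at hT'
    obtain ⟨U, hU, hUc⟩ := Finset.exists_subset_card_eq hT'.2
    simp only [Finset.mem_biUnion, Finset.mem_filter]
    exact ⟨U, Finset.mem_powersetCard.2 ⟨hU.trans Finset.inter_subset_left, hUc⟩, hT'.1,
      hU.trans Finset.inter_subset_right⟩
  refine (Finset.card_le_card hsub).trans ?_
  rw [← Finset.card_powersetCard]
  refine Finset.card_biUnion_le_card_mul _ _ _ fun U hU => ?_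
  have hU' := (Finset.mem_powersetCard.1 hU).2
  rw [Finset.card_filter_powersetCard_subset _ _ _ (Finset.subset_univ _) (by omega), hU',
    Finset.card_univ, Fintype.card_fin]

lemma card_powerset_filter_inter_eq_le (T T' X : Finset (Fin n)) :
    (T'.powerset.filter fun B => B ∩ (T ∩ T') = X).card ≤ 2 ^ (T'.card - (T ∩ T').card) := by
  have h : (T' \ T).card = T'.card - (T ∩ T').card := Finset.card_sdiff
  rw [← h, ← Finset.card_powerset]
  refine Finset.card_le_card_of_injOn (fun B => B \ T) ?_ ?_
  · intro B hB
    rw [Finset.mem_coe, Finset.mem_filter, Finset.mem_powerset] at hB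
    exact Finset.mem_coe.2 (Finset.mem_powerset.2 (Finset.sdiff_subset_sdiff hB.1 subset_rfl))
  · intro B hB B' hB' hBB
    rw [Finset.mem_coe, Finset.mem_filter, Finset.mem_powerset] at hB hB'
    ext x
    have h1 : x ∈ B ∩ (T ∩ T') ↔ x ∈ B' ∩ (T ∩ T') := by rw [hB.2, hB'.2]
    have h2 : x ∈ B \ T ↔ x ∈ B' \ T := by
      have : B \ T = B' \ T := hBB
      rw [this]
    have h3 := @hB.1 x
    have h4 := @hB'.1 x
    simp only [Finset.mem_inter, Finset.mem_sdiff] at h1 h2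
    tauto

open Classical in
lemma card_consistent_le (p : Σ _ : Finset (Fin n), Finset (Fin n)) (T' : Finset (Fin n)) :
    (((nonMin T').powerset.erase ∅).filter fun B =>
      (occurs p ∩ occurs ⟨T', B⟩).Nonempty).card ≤ 2 ^ (T'.card - (p.1 ∩ T').card + 1) := by
  have hsub : (((nonMin T').powerset.erase ∅).filter fun B =>
      (occurs p ∩ occurs ⟨T', B⟩).Nonempty) ⊆
      (T'.powerset.filter fun B => B ∩ (p.1 ∩ T') = p.2 ∩ (p.1 ∩ T')) ∪
      (T'.powerset.filter fun B => B ∩ (p.1 ∩ T') = (p.1 ∩ T') \ p.2) := by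
    intro B hB
    rw [Finset.mem_filter, Finset.mem_erase, Finset.mem_powerset] at hB
    obtain ⟨⟨-, hB⟩, ω, hp, hq⟩ := hB
    have hBT : B ∈ T'.powerset :=
      Finset.mem_powerset.2 (hB.trans (Finset.filter_subset _ _))
    rw [Finset.mem_union, Finset.mem_filter, Finset.mem_filter, ← and_or_left]
    exact ⟨hBT, consistent_of_mem_occurs hp hq⟩
  refine (Finset.card_le_card hsub).trans ((Finset.card_union_le _ _).trans ?_)
  rw [pow_succ, mul_two]
  exact add_le_add (card_powerset_filter_inter_eq_le _ _ _) (card_powerset_filter_inter_eq_le _ _ _)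

lemma choose_sub_eq {b i : ℕ} (hib : i ≤ b) (hin : i ≤ n) :
    ((n - i).choose (b - i) : ℝ) * 2 ^ i.choose 2 / 2 ^ b.choose 2 =
      f n b * (b.choose i / f n i) := by
  have h : (n.choose b : ℝ) * b.choose i = n.choose i * (n - i).choose (b - i) := by
    exact_mod_cast Nat.choose_mul hib
  have h0 : (n.choose i : ℝ) ≠ 0 := by exact_mod_cast (Nat.choose_pos hin).ne'
  rw [f_eq, f_eq]
  field_simp
  linarith

lemma sum_near_product_le {b w : ℕ} (hb : 2 ≤ b) (hn : 2 ≤ n)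
    (𝓑 : Finset (Fin n) → Finset (Finset (Fin n)))
    (h𝓑 : ∀ T ∈ Finset.powersetCard b Finset.univ, (𝓑 T).card = w)
    (p : Σ _ : Finset (Fin n), Finset (Fin n)) :
    ∑ q ∈ (Finset.powersetCard b Finset.univ).sigma 𝓑 with 2 ≤ (p.1 ∩ q.1).card,
      (erdosRenyi n (1 / 2)).real (occurs p) * (erdosRenyi n (1 / 2)).real (occurs q) ≤
    (erdosRenyi n (1 / 2)).real (occurs p) *
      ((f n b * w) * (p.1.card.choose 2 * b.choose 2 / n.choose 2)) := by
  rw [← Finset.mul_sum]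
  refine mul_le_mul_of_nonneg_left ?_ measureReal_nonneg
  rw [Finset.sum_filter, Finset.sum_sigma]
  have h1 : ∀ T ∈ Finset.powersetCard b (Finset.univ : Finset (Fin n)),
      (∑ B ∈ 𝓑 T, if 2 ≤ (p.1 ∩ T).card then (erdosRenyi n (1 / 2)).real (occurs ⟨T, B⟩) else 0) =
      if 2 ≤ (p.1 ∩ T).card then (w / 2 ^ b.choose 2 : ℝ) else 0 := by
    intro T hT
    split_ifs
    · simp only [measureReal_occurs, (Finset.mem_powersetCard.1 hT).2, Finset.sum_const, h𝓑 T hT,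
        nsmul_eq_mul, mul_one_div]
    · simp
  rw [Finset.sum_congr rfl h1, ← Finset.sum_filter, Finset.sum_const, nsmul_eq_mul]
  have h2 : (((Finset.powersetCard b Finset.univ).filter fun T' : Finset (Fin n) =>
      2 ≤ (p.1 ∩ T').card).card : ℝ) ≤ p.1.card.choose 2 * (n - 2).choose (b - 2) := by
    exact_mod_cast card_le_card_inter_le p.1 b 2
  have h3 : (n.choose b : ℝ) * b.choose 2 = n.choose 2 * (n - 2).choose (b - 2) := by
    exact_mod_cast Nat.choose_mul hb
  have h0 : (n.choose 2 : ℝ) ≠ 0 := by exact_mod_cast (Nat.choose_pos hn).ne'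
  refine (mul_le_mul_of_nonneg_right h2 (by positivity)).trans (le_of_eq ?_)
  rw [f_eq]
  field_simp
  linear_combination (-(p.1.card.choose 2 : ℝ)) * w * h3

open Classical in
lemma sum_near_inter_le {b M : ℕ} (hMb : M ≤ b + 1) (hMn : M ≤ n + 1)
    (𝓑 : Finset (Fin n) → Finset (Finset (Fin n))) (c : ℕ → ℝ) (hc0 : ∀ i, 0 ≤ c i)
    (p : Σ _ : Finset (Fin n), Finset (Fin n))
    (hc : ∀ T, T.card = b → (((𝓑 T).filter fun B =>
      (occurs p ∩ occurs ⟨T, B⟩).Nonempty).card : ℝ) ≤ c (p.1 ∩ T).card)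
    (hM : ∀ T, T.card = b → ∀ B ∈ 𝓑 T, (⟨T, B⟩ : Σ _ : Finset (Fin n), Finset (Fin n)) ≠ p →
      (occurs p ∩ occurs ⟨T, B⟩).Nonempty → (p.1 ∩ T).card < M) :
    ∑ q ∈ (Finset.powersetCard b Finset.univ).sigma 𝓑 with q ≠ p ∧ 2 ≤ (p.1 ∩ q.1).card,
      (erdosRenyi n (1 / 2)).real (occurs p ∩ occurs q) ≤
    1 / 2 ^ p.1.card.choose 2 *
      ∑ i ∈ Finset.Ico 2 M, f n b * c i * (p.1.card.choose i * b.choose i / f n i) := by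
  set a := p.1.card
  set r : ℕ → ℝ := fun i => c i * (2 ^ i.choose 2 / (2 ^ a.choose 2 * 2 ^ b.choose 2)) with hr
  have hr0 : ∀ i, 0 ≤ r i := fun i => mul_nonneg (hc0 i) (by positivity)
  rw [Finset.sum_filter, Finset.sum_sigma]
  have h1 : ∀ T ∈ Finset.powersetCard b (Finset.univ : Finset (Fin n)),
      (∑ B ∈ 𝓑 T, if (⟨T, B⟩ : Σ _ : Finset (Fin n), Finset (Fin n)) ≠ p ∧ 2 ≤ (p.1 ∩ T).card then
        (erdosRenyi n (1 / 2)).real (occurs p ∩ occurs ⟨T, B⟩) else 0) ≤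
      ∑ i ∈ Finset.Ico 2 M, if i ≤ (p.1 ∩ T).card then r i else 0 := by
    intro T hT
    have hTb := (Finset.mem_powersetCard.1 hT).2
    set i₀ := (p.1 ∩ T).card with hi₀
    by_cases hi : i₀ ∈ Finset.Ico 2 M
    · have h2 : r i₀ ≤ ∑ i ∈ Finset.Ico 2 M, if i ≤ i₀ then r i else 0 := by
        have := Finset.single_le_sum (f := fun i => if i ≤ i₀ then r i else 0)
          (fun i _ => by split_ifs; exacts [hr0 i, le_rfl]) hi
        simpa using this
      refine le_trans ?_ h2
      calc _ ≤ ∑ B ∈ 𝓑 T, if (occurs p ∩ occurs ⟨T, B⟩).Nonempty then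
            (2 ^ i₀.choose 2 / (2 ^ a.choose 2 * 2 ^ b.choose 2) : ℝ) else 0 := by
            refine Finset.sum_le_sum fun B _ => ?_
            by_cases hne : (occurs p ∩ occurs ⟨T, B⟩).Nonempty
            · rw [if_pos hne]
              have := measureReal_occurs_inter_le p ⟨T, B⟩
              simp only [hTb, ← hi₀] at this
              split_ifs
              · exact this
              · positivity
            · rw [if_neg hne, Set.not_nonempty_iff_eq_empty.1 hne, measureReal_empty, ite_self]
        _ ≤ r i₀ := by
            rw [← Finset.sum_filter, Finset.sum_const, nsmul_eq_mul]
            exact mul_le_mul_of_nonneg_right (hc T hTb) (by positivity)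
    · refine le_trans (le_of_eq (Finset.sum_eq_zero fun B hB => ?_))
        (Finset.sum_nonneg fun i _ => by split_ifs; exacts [hr0 i, le_rfl])
      split_ifs with h
      · by_contra hne
        have hne' : (occurs p ∩ occurs ⟨T, B⟩).Nonempty := by
          rw [Set.nonempty_iff_ne_empty]
          rintro he
          rw [he, measureReal_empty] at hne
          exact hne rfl
        exact hi (Finset.mem_Ico.2 ⟨h.2, hM T hTb B hB h.1 hne'⟩)
      · rfl
  refine (Finset.sum_le_sum h1).trans ?_
  rw [Finset.sum_comm, Finset.mul_sum]
  refine Finset.sum_le_sum fun i hi => ?_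
  rw [Finset.mem_Ico] at hi
  rw [← Finset.sum_filter, Finset.sum_const, nsmul_eq_mul]
  have h2 : (((Finset.powersetCard b Finset.univ).filter fun T' : Finset (Fin n) =>
      i ≤ (p.1 ∩ T').card).card : ℝ) ≤ a.choose i * (n - i).choose (b - i) := by
    exact_mod_cast card_le_card_inter_le p.1 b i
  refine (mul_le_mul_of_nonneg_right h2 (hr0 i)).trans (le_of_eq ?_)
  have h3 := choose_sub_eq (n := n) (b := b) (i := i) (by omega) (by omega)
  calc (a.choose i : ℝ) * (n - i).choose (b - i) * r i
      = 1 / 2 ^ a.choose 2 * c i * a.choose i *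
        ((n - i).choose (b - i) * 2 ^ i.choose 2 / 2 ^ b.choose 2) := by
        simp only [hr]
        field_simp
    _ = _ := by rw [h3]; ring

end Counting

section Bounds

variable {n k : ℕ} {c : ℝ}

lemma f_mul_two_pow_le {i : ℕ} (hi : i ≤ k + 2) :
    f n (k + 2) * 2 ^ (k + 2 - i + 1) ≤ 8 * g n k / 2 ^ i := by
  have h1 : (2 : ℝ) ^ (k + 2 - i + 1) * 2 ^ i = 4 * 2 ^ (k + 1) := by
    rw [← pow_add, show k + 2 - i + 1 + i = k + 1 + 2 by omega, pow_add]; ring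
  have h2 : (1 : ℝ) ≤ 2 ^ k := one_le_pow₀ one_le_two
  rw [le_div_iff₀ (by positivity), mul_assoc, h1, g_eq, pow_succ]
  nlinarith [mul_nonneg (f_nonneg n (k + 2)) (sub_nonneg.2 h2), f_nonneg n (k + 2)]

lemma sum_Ico_le_mul {M : ℕ} {F : ℕ → ℝ} {x : ℝ} (hx : 0 ≤ x) (hM : M ≤ k + 2)
    (hF : ∀ i ∈ Finset.Ico 2 M, F i ≤ x) : ∑ i ∈ Finset.Ico 2 M, F i ≤ (k + 2) * x := by
  refine (Finset.sum_le_card_nsmul _ _ _ hF).trans ?_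
  rw [nsmul_eq_mul, Nat.card_Ico]
  refine mul_le_mul_of_nonneg_right ?_ hx
  have : M - 2 ≤ k + 2 := by omega
  exact_mod_cast this

lemma disjoint_indepPatterns_bipPatterns (n k : ℕ) :
    Disjoint (indepPatterns n k) (bipPatterns n (k + 2)) := by
  rw [Finset.disjoint_left]
  intro p hp hq
  have := (mem_indepPatterns.1 hp).1
  have := (mem_bipPatterns.1 hq).1
  omega

lemma sum_measureReal_patterns (n k : ℕ) :
    ∑ p ∈ indepPatterns n k ∪ bipPatterns n (k + 2), (erdosRenyi n (1 / 2)).real (occurs p) =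
      f n k + g n k := by
  rw [Finset.sum_union (disjoint_indepPatterns_bipPatterns n k), sum_measureReal_indepPatterns,
    sum_measureReal_bipPatterns]

lemma choose_two_mul_div_le {a b : ℕ} (h : IsThreshold n k) (ha : a ≤ k + 2) (hb : b ≤ k + 2) :
    (a.choose 2 * b.choose 2 / n.choose 2 : ℝ) ≤ (k + 2) ^ 4 / 2 ^ (k / 6) := by
  have hK : ∀ a ≤ k + 2, (a.choose 2 : ℝ) ≤ (k + 2) ^ 2 := by
    intro a ha
    exact_mod_cast (Nat.choose_le_pow a 2).trans (Nat.pow_le_pow_left ha 2)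
  have hn : (2 : ℝ) ^ (k / 6) ≤ n.choose 2 := by
    refine h.two_pow_le_n.trans ?_
    have h1 := h.two_mul_le
    have h2 := h.pos
    have h3 : n ≤ n.choose 2 := by
      obtain ⟨m, rfl⟩ : ∃ m, n = m + 3 := ⟨n - 3, by omega⟩
      rw [choose_two_succ, choose_two_succ]
      omega
    exact_mod_cast h3
  calc (a.choose 2 * b.choose 2 / n.choose 2 : ℝ)
      ≤ (k + 2) ^ 2 * (k + 2) ^ 2 / 2 ^ (k / 6) := by
        gcongr
        · exact hK a ha
        · exact hK b hb
    _ = _ := by ring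

lemma card_le_of_mem_patterns {p : Σ _ : Finset (Fin n), Finset (Fin n)}
    (hp : p ∈ indepPatterns n k ∪ bipPatterns n (k + 2)) : k ≤ p.1.card ∧ p.1.card ≤ k + 2 := by
  rcases Finset.mem_union.1 hp with hp | hp
  · have := (mem_indepPatterns.1 hp).1; omega
  · have := (mem_bipPatterns.1 hp).1; omega

lemma sum_near_product_patterns_le (h : IsThreshold n k) (hk2 : 2 ≤ k) (hc : f n k ≤ c) :
    ∑ p ∈ indepPatterns n k ∪ bipPatterns n (k + 2),
      ∑ q ∈ indepPatterns n k ∪ bipPatterns n (k + 2) with 2 ≤ (p.1 ∩ q.1).card,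
        (erdosRenyi n (1 / 2)).real (occurs p) * (erdosRenyi n (1 / 2)).real (occurs q) ≤
      4 * c ^ 2 * ((k + 2) ^ 4 / 2 ^ (k / 6)) := by
  set ε : ℝ := (k + 2) ^ 4 / 2 ^ (k / 6) with hε
  have hε0 : 0 ≤ ε := by positivity
  have hn := h.two_mul_le
  have hg := h.g_le.trans hc
  have hf0 := f_nonneg n k
  have hc0 : 0 ≤ c := hf0.trans hc
  have hrow : ∀ p ∈ indepPatterns n k ∪ bipPatterns n (k + 2),
      ∑ q ∈ indepPatterns n k ∪ bipPatterns n (k + 2) with 2 ≤ (p.1 ∩ q.1).card,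
        (erdosRenyi n (1 / 2)).real (occurs p) * (erdosRenyi n (1 / 2)).real (occurs q) ≤
      (erdosRenyi n (1 / 2)).real (occurs p) * (2 * c * ε) := by
    intro p hp
    have hpk := (card_le_of_mem_patterns hp).2
    rw [Finset.filter_union, Finset.sum_union
      (Finset.disjoint_filter_filter (disjoint_indepPatterns_bipPatterns n k))]
    have h1 := sum_near_product_le hk2 (by omega : 2 ≤ n)
      (fun _ => ({∅} : Finset (Finset (Fin n)))) (w := 1) (fun _ _ => Finset.card_singleton _) p
    have h2 := sum_near_product_le (by omega : 2 ≤ k + 2) (by omega : 2 ≤ n)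
      (fun T : Finset (Fin n) => (nonMin T).powerset.erase ∅) (w := 2 ^ (k + 1) - 1)
      (fun T hT => card_bipParts (Finset.mem_powersetCard.1 hT).2) p
    rw [Nat.cast_sub Nat.one_le_two_pow] at h2
    push_cast at h1 h2
    rw [← g_eq] at h2
    refine (add_le_add h1 h2).trans ?_
    rw [← mul_add]
    refine mul_le_mul_of_nonneg_left ?_ measureReal_nonneg
    have e1 := choose_two_mul_div_le h hpk (by omega : k ≤ k + 2)
    have e2 := choose_two_mul_div_le h hpk (le_refl (k + 2))
    calc _ ≤ c * ε + c * ε := by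
          rw [mul_one]
          refine add_le_add (mul_le_mul hc e1 (by positivity) hc0)
            (mul_le_mul hg e2 (by positivity) hc0)
      _ = 2 * c * ε := by ring
  refine (Finset.sum_le_sum hrow).trans ?_
  rw [← Finset.sum_mul, sum_measureReal_patterns]
  calc (f n k + g n k) * (2 * c * ε) ≤ (c + c) * (2 * c * ε) := by gcongr
    _ = _ := by ring

lemma f_pos {i : ℕ} (hi : i ≤ n) : 0 < f n i := by
  rw [f_eq]
  have := Nat.choose_pos hi
  positivity

lemma sum_near_inter_indep_indep_le (h : IsThreshold n k) (hk : ((k : ℝ) + 2) ^ 3 ≤ 2 ^ (k / 6))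
    (hc : f n k ≤ c) :
    ∑ p ∈ indepPatterns n k, ∑ q ∈ indepPatterns n k with q ≠ p ∧ 2 ≤ (p.1 ∩ q.1).card,
        (erdosRenyi n (1 / 2)).real (occurs p ∩ occurs q) ≤
      c * ((k + 2) * (c * ((k + 2) ^ 4 / 2 ^ (k / 6)))) := by
  classical
  have hn := h.two_mul_le
  have hc0 : 0 ≤ c := (f_nonneg n k).trans hc
  have hrow : ∀ p ∈ indepPatterns n k,
      ∑ q ∈ indepPatterns n k with q ≠ p ∧ 2 ≤ (p.1 ∩ q.1).card,
        (erdosRenyi n (1 / 2)).real (occurs p ∩ occurs q) ≤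
      (erdosRenyi n (1 / 2)).real (occurs p) *
        ((k + 2) * (c * ((k + 2) ^ 4 / 2 ^ (k / 6)))) := by
    intro p hp
    obtain ⟨hpk, hp2⟩ := mem_indepPatterns.1 hp
    refine (sum_near_inter_le (b := k) (M := k) (by omega) (by omega) (fun _ => {∅}) (fun _ => 1)
      (fun _ => zero_le_one) p ?_ ?_).trans ?_
    · intro T _
      exact_mod_cast (Finset.card_filter_le _ _).trans (Finset.card_singleton _).le
    · intro T hT B hB hne _
      rw [Finset.mem_singleton] at hB
      subst hB
      refine lt_of_le_of_ne (hT ▸ Finset.card_le_card Finset.inter_subset_right) fun he => hne ?_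
      have h1 : p.1 ∩ T = p.1 := Finset.eq_of_subset_of_card_le Finset.inter_subset_left (by omega)
      have h2 : p.1 ∩ T = T := Finset.eq_of_subset_of_card_le Finset.inter_subset_right (by omega)
      have h3 : T = p.1 := h2.symm.trans h1
      obtain ⟨p1, p2⟩ := p
      simp only at h3 hp2
      rw [h3, hp2]
    · rw [measureReal_occurs]
      refine mul_le_mul_of_nonneg_left (sum_Ico_le_mul (by positivity) (by omega) ?_)
        (by positivity)
      intro i hi
      rw [Finset.mem_Ico] at hi
      rw [mul_one, hpk, ← sq]
      refine mul_le_mul hc ?_ (by have := f_nonneg n i; positivity) hc0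
      rw [div_le_iff₀ (f_pos (by omega))]
      refine (h.choose_sq_le hk (by omega) hi.2).trans ?_
      refine mul_le_mul_of_nonneg_right ?_ (f_nonneg n i)
      gcongr
      · linarith [(k.cast_nonneg : (0 : ℝ) ≤ k)]
      · norm_num
  refine (Finset.sum_le_sum hrow).trans ?_
  rw [← Finset.sum_mul, sum_measureReal_indepPatterns]
  gcongr

lemma sum_near_inter_bip_le (h : IsThreshold n k) (hk : ((k : ℝ) + 2) ^ 3 ≤ 2 ^ (k / 6))
    (hc : f n k ≤ c) {M : ℕ} (hM : M ≤ k + 2) {p : Σ _ : Finset (Fin n), Finset (Fin n)}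
    (hpk : p.1.card ≤ k + 2)
    (hpM : ∀ T, T.card = k + 2 → ∀ B ∈ (nonMin T).powerset.erase ∅,
      (⟨T, B⟩ : Σ _ : Finset (Fin n), Finset (Fin n)) ≠ p →
      (occurs p ∩ occurs ⟨T, B⟩).Nonempty → (p.1 ∩ T).card < M) :
    ∑ q ∈ bipPatterns n (k + 2) with q ≠ p ∧ 2 ≤ (p.1 ∩ q.1).card,
        (erdosRenyi n (1 / 2)).real (occurs p ∩ occurs q) ≤
      (erdosRenyi n (1 / 2)).real (occurs p) *
        ((k + 2) * (8 * c * ((k + 2) ^ 4 / 2 ^ (k / 6)))) := by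
  classical
  have hn := h.two_mul_le
  have hg := h.g_le.trans hc
  have hc0 : 0 ≤ c := (f_nonneg n k).trans hc
  refine (sum_near_inter_le (b := k + 2) (M := M) (by omega) (by omega)
    (fun T => (nonMin T).powerset.erase ∅) (fun i => 2 ^ (k + 2 - i + 1))
    (fun _ => by positivity) p ?_ hpM).trans ?_
  · intro T hT
    have := card_consistent_le p T
    rw [hT] at this
    exact_mod_cast this
  · rw [measureReal_occurs]
    refine mul_le_mul_of_nonneg_left (sum_Ico_le_mul (by positivity) hM ?_) (by positivity)
    intro i hi
    rw [Finset.mem_Ico] at hi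
    have hfi : 0 < f n i := f_pos (by omega)
    have h1 : (p.1.card.choose i : ℝ) ≤ (k + 2).choose i := by
      exact_mod_cast Nat.choose_le_choose i hpk
    calc f n (k + 2) * 2 ^ (k + 2 - i + 1) * (p.1.card.choose i * (k + 2).choose i / f n i)
        ≤ 8 * c / 2 ^ i * (((k + 2).choose i : ℝ) ^ 2 / f n i) := by
          refine mul_le_mul ((f_mul_two_pow_le (by omega)).trans (by gcongr)) ?_ (by positivity)
            (by positivity)
          rw [sq]
          gcongr
      _ = 8 * c * (((k + 2).choose i : ℝ) ^ 2 / 2 ^ i / f n i) := by ring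
      _ ≤ _ := by
          refine mul_le_mul_of_nonneg_left ?_ (by positivity)
          rw [div_le_iff₀ hfi]
          exact h.choose_add_two_sq_le hk (by omega) (by omega)

lemma sum_near_inter_indep_bip_le (h : IsThreshold n k) (hk : ((k : ℝ) + 2) ^ 3 ≤ 2 ^ (k / 6))
    (hc : f n k ≤ c) :
    ∑ p ∈ indepPatterns n k, ∑ q ∈ bipPatterns n (k + 2) with q ≠ p ∧ 2 ≤ (p.1 ∩ q.1).card,
        (erdosRenyi n (1 / 2)).real (occurs p ∩ occurs q) ≤
      c * ((k + 2) * (8 * c * ((k + 2) ^ 4 / 2 ^ (k / 6)))) := by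
  have hc0 : 0 ≤ c := (f_nonneg n k).trans hc
  refine (Finset.sum_le_sum fun p hp => sum_near_inter_bip_le h hk hc (M := k + 1) (by omega)
    (by rw [(mem_indepPatterns.1 hp).1]; omega) ?_).trans ?_
  · intro T _ B _ _ _
    have := Finset.card_le_card (Finset.inter_subset_left (s₁ := p.1) (s₂ := T))
    rw [(mem_indepPatterns.1 hp).1] at this
    omega
  · rw [← Finset.sum_mul, sum_measureReal_indepPatterns]
    gcongr

/-- Two different partitions of the same vertex set never occur together. -/
lemma eq_of_mem_occurs_of_fst_eq {T B B' : Finset (Fin n)} {ω : Sym2 (Fin n) → Bool}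
    (hT : T.Nonempty) (hB : B ⊆ nonMin T) (hB' : B' ⊆ nonMin T)
    (h : ω ∈ occurs ⟨T, B⟩) (h' : ω ∈ occurs ⟨T, B'⟩) : B' = B := by
  obtain ⟨r, hr, hrT⟩ := exists_nonMin_eq_erase hT
  rw [hrT] at hB hB'
  have key := consistent_of_mem_occurs h h'
  simp only [Finset.inter_self] at key
  rw [Finset.inter_eq_left.2 (hB.trans (Finset.erase_subset _ _)),
    Finset.inter_eq_left.2 (hB'.trans (Finset.erase_subset _ _))] at key
  refine key.resolve_right fun he => ?_
  have hrB : r ∉ B := fun hmem => Finset.notMem_erase r T (hB hmem)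
  exact Finset.notMem_erase r T (hB' (he ▸ Finset.mem_sdiff.2 ⟨hr, hrB⟩))

lemma sum_near_inter_bip_bip_le (h : IsThreshold n k) (hk : ((k : ℝ) + 2) ^ 3 ≤ 2 ^ (k / 6))
    (hc : f n k ≤ c) :
    ∑ p ∈ bipPatterns n (k + 2), ∑ q ∈ bipPatterns n (k + 2) with q ≠ p ∧ 2 ≤ (p.1 ∩ q.1).card,
        (erdosRenyi n (1 / 2)).real (occurs p ∩ occurs q) ≤
      c * ((k + 2) * (8 * c * ((k + 2) ^ 4 / 2 ^ (k / 6)))) := by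
  have hc0 : 0 ≤ c := (f_nonneg n k).trans hc
  have hg := h.g_le.trans hc
  refine (Finset.sum_le_sum fun p hp => sum_near_inter_bip_le h hk hc (M := k + 2) le_rfl
    (mem_bipPatterns.1 hp).1.le ?_).trans ?_
  · rintro T hT B hB hne ⟨ω, hp', hq'⟩
    obtain ⟨p1, p2⟩ := p
    obtain ⟨hpk, -, hpB⟩ := mem_bipPatterns.1 hp
    simp only at hpk hpB ⊢
    rw [Finset.mem_erase, Finset.mem_powerset] at hB
    refine lt_of_le_of_ne (hT ▸ Finset.card_le_card Finset.inter_subset_right) fun he => hne ?_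
    have h1 : p1 ∩ T = p1 := Finset.eq_of_subset_of_card_le Finset.inter_subset_left (by omega)
    have h2 : p1 ∩ T = T := Finset.eq_of_subset_of_card_le Finset.inter_subset_right (by omega)
    obtain rfl : T = p1 := h2.symm.trans h1
    rw [eq_of_mem_occurs_of_fst_eq (Finset.card_pos.1 (by omega)) hpB hB.2 hp' hq']
  · rw [← Finset.sum_mul, sum_measureReal_bipPatterns]
    gcongr

lemma sum_near_inter_patterns_le (h : IsThreshold n k) (hk : ((k : ℝ) + 2) ^ 3 ≤ 2 ^ (k / 6))
    (hc : f n k ≤ c) :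
    ∑ p ∈ indepPatterns n k ∪ bipPatterns n (k + 2),
      ∑ q ∈ indepPatterns n k ∪ bipPatterns n (k + 2) with q ≠ p ∧ 2 ≤ (p.1 ∩ q.1).card,
        (erdosRenyi n (1 / 2)).real (occurs p ∩ occurs q) ≤
      25 * c ^ 2 * ((k + 2) ^ 5 / 2 ^ (k / 6)) := by
  have hd := disjoint_indepPatterns_bipPatterns n k
  have hsymm : ∑ p ∈ bipPatterns n (k + 2),
      ∑ q ∈ indepPatterns n k with q ≠ p ∧ 2 ≤ (p.1 ∩ q.1).card,
        (erdosRenyi n (1 / 2)).real (occurs p ∩ occurs q) =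
      ∑ p ∈ indepPatterns n k, ∑ q ∈ bipPatterns n (k + 2) with q ≠ p ∧ 2 ≤ (p.1 ∩ q.1).card,
        (erdosRenyi n (1 / 2)).real (occurs p ∩ occurs q) := by
    simp_rw [Finset.sum_filter]
    rw [Finset.sum_comm]
    refine Finset.sum_congr rfl fun p _ => Finset.sum_congr rfl fun q _ => ?_
    rw [Finset.inter_comm, Set.inter_comm]
    exact if_congr (and_congr_left fun _ => ne_comm) rfl rfl
  simp_rw [Finset.filter_union, Finset.sum_union (Finset.disjoint_filter_filter hd)]
  rw [Finset.sum_union hd, Finset.sum_add_distrib, Finset.sum_add_distrib, hsymm]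
  have h1 := sum_near_inter_indep_indep_le h hk hc
  have h2 := sum_near_inter_indep_bip_le h hk hc
  have h3 := sum_near_inter_bip_bip_le h hk hc
  refine (add_le_add (add_le_add h1 h2) (add_le_add h2 h3)).trans (le_of_eq ?_)
  ring

theorem abs_measureReal_none_sub_exp_le (h : IsThreshold n k)
    (hk : ((k : ℝ) + 2) ^ 3 ≤ 2 ^ (k / 6)) (hk2 : 2 ≤ k) (hc : f n k ≤ c) :
    |(erdosRenyi n (1 / 2)).real {ω | numIndep n k ω = 0 ∧ numBip n (k + 2) ω = 0} -
      exp (-(f n k) - g n k)| ≤ 29 * c ^ 2 * ((k + 2) ^ 5 / 2 ^ (k / 6)) := by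
  have key := abs_measureReal_none_occurs_sub_exp_le (erdosRenyi n (1 / 2))
    (indepPatterns n k ∪ bipPatterns n (k + 2)) occurs (fun p q => 2 ≤ (p.1 ∩ q.1).card)
    (fun p hp => by
      rw [Finset.inter_self]
      exact hk2.trans (card_le_of_mem_patterns hp).1)
    (fun p _ => indepFun_occurs p _ fun q hq => (Finset.mem_filter.1 hq).2)
  simp_rw [none_occurs_iff]
  rw [sum_measureReal_patterns, neg_add', Finset.sum_add_distrib] at key
  refine key.trans ((add_le_add (sum_near_product_patterns_le h hk2 hc)
    (sum_near_inter_patterns_le h hk hc)).trans ?_)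
  have h4 : ((k : ℝ) + 2) ^ 4 / 2 ^ (k / 6) ≤ (k + 2) ^ 5 / 2 ^ (k / 6) := by
    gcongr
    · linarith [(k.cast_nonneg : (0 : ℝ) ≤ k)]
    · norm_num
  nlinarith [mul_le_mul_of_nonneg_left h4 (sq_nonneg c)]

end Bounds

section Limit

lemma le_eight_pow_k0 (n : ℕ) : n ≤ 8 ^ k0 n := by
  rcases lt_or_ge n (k0 n + 1) with h | h
  · exact (Nat.lt_succ_iff.1 h).trans (Nat.lt_pow_self (by norm_num)).le
  · have h1 : n ^ 2 < (k0 n + 1) ^ 2 * 2 ^ k0 n := by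
      exact_mod_cast sq_lt_of_f_succ_lt_one h (f_k0_succ_lt_one n)
    have h2 : k0 n + 1 ≤ 2 ^ k0 n := Nat.lt_two_pow_self
    calc n ≤ n ^ 2 := Nat.le_self_pow two_ne_zero n
      _ ≤ (2 ^ k0 n) ^ 2 * 2 ^ k0 n := h1.le.trans (by gcongr)
      _ = 8 ^ k0 n := by rw [← pow_succ, ← pow_mul, mul_comm, pow_mul]; norm_num

lemma tendsto_k0_atTop : Tendsto k0 atTop atTop := by
  refine tendsto_atTop.2 fun b => (eventually_ge_atTop (8 ^ b)).mono fun n hn => ?_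
  exact (Nat.pow_le_pow_iff_right (by norm_num : 1 < 8)).1 (hn.trans (le_eight_pow_k0 n))

lemma isThreshold_k0 {n : ℕ} (hk2 : 2 ≤ k0 n) (hk : ((k0 n : ℝ) + 2) ^ 3 ≤ 2 ^ (k0 n / 6)) :
    IsThreshold n (k0 n) := by
  have hpow := two_pow_pred_le_sq (by omega) (one_le_f_k0 n)
  have hn : 2 * (k0 n + 2) ≤ n := by
    have h1 : (k0 n + 2) ^ 3 ≤ 2 ^ (k0 n / 6) := by exact_mod_cast hk
    have h2 : 2 ^ (k0 n - 1) ≤ n ^ 2 := by exact_mod_cast hpow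
    refine (Nat.pow_le_pow_iff_left two_ne_zero).1 (le_trans ?_ h2)
    calc (2 * (k0 n + 2)) ^ 2 = 4 * (k0 n + 2) ^ 2 := by ring
      _ ≤ (k0 n + 2) * (k0 n + 2) ^ 2 := by gcongr; omega
      _ = (k0 n + 2) ^ 3 := by ring
      _ ≤ 2 ^ (k0 n / 6) := h1
      _ ≤ 2 ^ (k0 n - 1) := Nat.pow_le_pow_right two_pos (by omega)
  exact ⟨by omega, hn, one_le_f_k0 n, hpow,
    (sq_lt_of_f_succ_lt_one (by omega) (f_k0_succ_lt_one n)).le⟩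

lemma tendsto_add_two_pow_div_two_pow :
    Tendsto (fun k : ℕ => ((k : ℝ) + 2) ^ 5 / 2 ^ (k / 6)) atTop (nhds 0) := by
  have h1 : Tendsto (fun m : ℕ => (m : ℝ) ^ 5 / 2 ^ m) atTop (nhds 0) :=
    tendsto_pow_const_div_const_pow_of_one_lt 5 one_lt_two
  have h2 : Tendsto (fun k : ℕ => k / 6 + 1) atTop atTop :=
    (tendsto_add_atTop_nat 1).comp (Nat.tendsto_div_const_atTop (by norm_num : (6 : ℕ) ≠ 0))
  have h3 := (h1.comp h2).const_mul (2 * 7 ^ 5)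
  rw [mul_zero] at h3
  refine squeeze_zero (fun k => by positivity) (fun k => ?_) h3
  have hk : (k : ℝ) + 2 ≤ 7 * ((k / 6 + 1 : ℕ) : ℝ) := by
    exact_mod_cast (by omega : k + 2 ≤ 7 * (k / 6 + 1))
  calc ((k : ℝ) + 2) ^ 5 / 2 ^ (k / 6) ≤ (7 * ((k / 6 + 1 : ℕ) : ℝ)) ^ 5 / 2 ^ (k / 6) := by gcongr
    _ = _ := by simp only [Function.comp, pow_succ]; field_simp

end Limit

/-- along a sequence with `c1 ≤ f(k₀) ≤ c2`, `λ = f(k₀)` and `μ = g(k₀)`,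
`|P(X = 0 and Y = 0) - e^{-λ-μ}| → 0`. -/
theorem poisson_approx_joint
    (c1 c2 : ℝ) (hc1 : 0 < c1) (hc12 : c1 ≤ c2)
    (s : ℕ → ℕ) (hs : StrictMono s)
    (hf : ∀ j, c1 ≤ f (s j) (k0 (s j)) ∧ f (s j) (k0 (s j)) ≤ c2) :
    Tendsto (fun j =>
      |(erdosRenyi (s j) (1/2)
          {ω | numIndep (s j) (k0 (s j)) ω = 0 ∧ numBip (s j) (k0 (s j) + 2) ω = 0}).toReal -
        Real.exp (-(f (s j) (k0 (s j))) - g (s j) (k0 (s j)))|) atTop (nhds 0) := by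
  have hk : Tendsto (fun j => k0 (s j)) atTop atTop := tendsto_k0_atTop.comp hs.tendsto_atTop
  have hlim := tendsto_add_two_pow_div_two_pow.comp hk
  have hbound := hlim.const_mul (29 * c2 ^ 2)
  rw [mul_zero] at hbound
  refine squeeze_zero' (Eventually.of_forall fun j => abs_nonneg _) ?_ hbound
  filter_upwards [hk.eventually_ge_atTop 2, hlim.eventually_le_const one_pos] with j hj2 hj
  have hj3 : ((k0 (s j) : ℝ) + 2) ^ 3 ≤ 2 ^ (k0 (s j) / 6) := by
    rw [Function.comp, div_le_one (by positivity)] at hj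
    refine le_trans ?_ hj
    gcongr
    · linarith [(k0 (s j)).cast_nonneg (α := ℝ)]
    · norm_num
  exact abs_measureReal_none_sub_exp_le (isThreshold_k0 hj2 hj3) hj3 hj2 (hf j).2

end RandomBipartiteDecomposition
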